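/- arXiv:1702.02446 — 2 statements merged into one kernel-verified Lean document; each statement's English description precedes it below -/
import Mathlib

section
/- For n ≥ 1 and 0 ≤ k ≤ n−1, the number of weight 0 maxmin trees on n+1 vertices having exactly k+1 maxima equals the Eulerian number A(k,n), the number of permutations in S_n with exactly k descents; i.e., there is a bijection between permutations in S_n with k descents and weight 0 maxmin trees on n+1 vertices with k+1 maxima. -/
open scoped Classical

/-- Reachability along a finite edge set (edges are unordered pairs of naturals). -/
def EReach (E : Finset (Sym2 ℕ)) : ℕ → ℕ → Prop :=
  Relation.ReflTransGen fun a b => s(a, b) ∈ E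

/-- `E` is the edge set of a tree on the vertex set `V`: all edges join distinct
vertices of `V`, any two vertices of `V` are joined by a walk, and the number of
edges is one less than the number of vertices. -/
def IsTreeOn (V : Finset ℕ) (E : Finset (Sym2 ℕ)) : Prop :=
  (∀ e ∈ E, ∀ x ∈ e, x ∈ V) ∧ (∀ e ∈ E, ¬ e.IsDiag) ∧
    (∀ a ∈ V, ∀ b ∈ V, EReach E a b) ∧ E.card + 1 = V.card

/-- `t` is a tiering function (with tiers `1, …, m`) for the graph with vertex set `V`
and edge set `E`: tiers lie in `{1, …, m}` and if `a < b` are adjacent then `t a < t b`. -/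
def IsTieredOn (V : Finset ℕ) (E : Finset (Sym2 ℕ)) (m : ℕ) (t : ℕ → ℕ) : Prop :=
  (∀ v ∈ V, t v ∈ Finset.Icc 1 m) ∧ ∀ a b : ℕ, s(a, b) ∈ E → a < b → t a < t b

/-- Auxiliary fuelled recursion computing the weight of a tiered tree: delete the
minimal vertex `v`, and sum, over the components `C` of the resulting forest
(one for each neighbour `u` of `v`), the weight of the component plus the number
of vertices `x ∈ C` with `t x > t v` and `x < u`.  (Fuel `V.card` always suffices,
since components are strictly smaller.) -/
noncomputable def treeWeightAux (t : ℕ → ℕ) : ℕ → Finset ℕ → Finset (Sym2 ℕ) → ℕ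
  | 0, _, _ => 0
  | fuel + 1, V, E =>
    if h : 2 ≤ V.card then
      let v := V.min' (Finset.card_pos.mp (by omega))
      let E' := E.filter fun e => v ∉ e
      ((V.erase v).filter fun u => s(v, u) ∈ E).sum fun u =>
        let C := (V.erase v).filter fun x => EReach E' u x
        (C.filter fun x => t v < t x ∧ x < u).card +
          treeWeightAux t fuel C (E'.filter fun e => ∀ x ∈ e, x ∈ C)
    else 0

/-- The weight of a tiered tree with vertex set `V`, edge set `E` and tiering function `t`. -/
noncomputable def treeWeight (V : Finset ℕ) (E : Finset (Sym2 ℕ)) (t : ℕ → ℕ) : ℕ :=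
  treeWeightAux t V.card V E

/-- The word `π(1) π(2) … π(n)` of a permutation of `{1,…,n}` (as a list of the
letters `1,…,n`). -/
def permList {n : ℕ} (π : Equiv.Perm (Fin n)) : List ℕ :=
  (List.finRange n).map fun i => (π i : ℕ) + 1

/-- The number of descents of a word: positions `i` with `l i > l (i+1)`. -/
def descCount : List ℕ → ℕ
  | a :: b :: r => (if b < a then 1 else 0) + descCount (b :: r)
  | _ => 0

/-! ### Reachability along a finite edge set -/

lemma EReach.of_closed {E F : Finset (Sym2 ℕ)} {S : Finset ℕ}
    (h : ∀ a ∈ S, ∀ b, s(a, b) ∈ E → s(a, b) ∈ F ∧ b ∈ S) {a x : ℕ} (ha : a ∈ S)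
    (hr : EReach E a x) : EReach F a x ∧ x ∈ S := by
  induction hr with
  | refl => exact ⟨.refl, ha⟩
  | tail _ hbc ih => exact ⟨ih.1.tail (h _ ih.2 _ hbc).1, (h _ ih.2 _ hbc).2⟩

lemma EReach.mono {E F : Finset (Sym2 ℕ)} (h : E ⊆ F) {a b : ℕ} (hr : EReach E a b) :
    EReach F a b :=
  Relation.ReflTransGen.mono (fun _ _ hab => h hab) _ _ hr

lemma EReach.symm {E : Finset (Sym2 ℕ)} {a b : ℕ} (hr : EReach E a b) : EReach E b a := by
  induction hr with
  | refl => exact .refl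
  | tail _ hbc ih => exact .head (by rwa [Sym2.eq_swap]) ih

/-- If every vertex of `V` is reachable from `R`, then `V` has at most `#E + #R` vertices. -/
lemma card_le_of_reach (E : Finset (Sym2 ℕ)) (V R : Finset ℕ)
    (h : ∀ x ∈ V, ∃ r ∈ R, EReach E r x) : V.card ≤ E.card + R.card := by
  induction E using Finset.induction_on generalizing R with
  | empty =>
    have : V ⊆ R := fun x hx => by
      obtain ⟨r, hr, hrx⟩ := h x hx
      rcases Relation.ReflTransGen.cases_tail hrx with h' | ⟨c, _, h'⟩
      · exact h' ▸ hr
      · simp at h'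
    simpa using Finset.card_le_card this
  | insert e E he ih =>
    rw [Finset.card_insert_of_notMem he]
    induction e using Sym2.ind with | _ p q
    have cover : ∀ R' : Finset ℕ, R ⊆ R' → (∀ b c, s(b, c) = s(p, q) →
        (∃ r ∈ R', EReach E r b) → ∃ r ∈ R', EReach E r c) →
        ∀ x ∈ V, ∃ r ∈ R', EReach E r x := by
      intro R' hR hcl x hx
      obtain ⟨r, hr, hrx⟩ := h x hx
      clear hx
      induction hrx with
      | refl => exact ⟨r, hR hr, .refl⟩
      | tail _ hbc ih' =>
        rcases Finset.mem_insert.mp hbc with hbc | hbc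
        · exact hcl _ _ hbc ih'
        · obtain ⟨r', hr', hb⟩ := ih'
          exact ⟨r', hr', hb.tail hbc⟩
    have grow : ∀ a b, s(a, b) = s(p, q) → (∃ r ∈ R, EReach E r a) →
        V.card ≤ E.card + 1 + R.card := by
      rintro a b hab ⟨r, hr, hra⟩
      have := ih _ (cover (insert b R) (Finset.subset_insert _ _) (by
        intro c d hcd _
        rw [← hab, Sym2.eq_iff] at hcd
        rcases hcd with ⟨_, rfl⟩ | ⟨_, rfl⟩
        · exact ⟨d, by simp, .refl⟩
        · exact ⟨r, by simp [hr], hra⟩))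
      have := Finset.card_insert_le b R
      omega
    by_cases hp : ∃ r ∈ R, EReach E r p
    · exact grow p q rfl hp
    by_cases hq : ∃ r ∈ R, EReach E r q
    · exact grow q p Sym2.eq_swap hq
    have := ih R (cover R subset_rfl (by
      intro b c hbc hb
      rcases Sym2.eq_iff.mp hbc with ⟨rfl, _⟩ | ⟨rfl, _⟩
      · exact absurd hb hp
      · exact absurd hb hq))
    omega

/-! ### Cutting and joining trees along an edge -/

/-- The vertex set `V` and edge set `E` of a tree obtained from trees on the disjoint vertex sets
`V₁` and `V₂` by adding an edge between `v ∈ V₁` and `u ∈ V₂`. -/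
structure IsJoin (V : Finset ℕ) (E : Finset (Sym2 ℕ)) (v u : ℕ) (V₁ V₂ : Finset ℕ)
    (E₁ E₂ : Finset (Sym2 ℕ)) : Prop where
  tree₁ : IsTreeOn V₁ E₁
  tree₂ : IsTreeOn V₂ E₂
  disj : Disjoint V₁ V₂
  mem₁ : v ∈ V₁
  mem₂ : u ∈ V₂
  verts : V = V₁ ∪ V₂
  edges : E = insert s(v, u) (E₁ ∪ E₂)

namespace IsJoin

variable {V : Finset ℕ} {E : Finset (Sym2 ℕ)} {v u : ℕ} {V₁ V₂ : Finset ℕ}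
  {E₁ E₂ : Finset (Sym2 ℕ)}

lemma notMem₂ (h : IsJoin V E v u V₁ V₂ E₁ E₂) {x : ℕ} (hx : x ∈ V₁) : x ∉ V₂ :=
  Finset.disjoint_left.mp h.disj hx

lemma notMem₁ (h : IsJoin V E v u V₁ V₂ E₁ E₂) {x : ℕ} (hx : x ∈ V₂) : x ∉ V₁ :=
  Finset.disjoint_right.mp h.disj hx

lemma mem_edges (h : IsJoin V E v u V₁ V₂ E₁ E₂) {e : Sym2 ℕ} :
    e ∈ E ↔ e = s(v, u) ∨ e ∈ E₁ ∨ e ∈ E₂ := by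
  simp [h.edges]

lemma mem_of_mem₁ (h : IsJoin V E v u V₁ V₂ E₁ E₂) {a b : ℕ} (hab : s(a, b) ∈ E₁) :
    a ∈ V₁ ∧ b ∈ V₁ :=
  ⟨h.tree₁.1 _ hab a (by simp), h.tree₁.1 _ hab b (by simp)⟩

lemma mem_of_mem₂ (h : IsJoin V E v u V₁ V₂ E₁ E₂) {a b : ℕ} (hab : s(a, b) ∈ E₂) :
    a ∈ V₂ ∧ b ∈ V₂ :=
  ⟨h.tree₂.1 _ hab a (by simp), h.tree₂.1 _ hab b (by simp)⟩

lemma isTreeOn (h : IsJoin V E v u V₁ V₂ E₁ E₂) : IsTreeOn V E := by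
  obtain ⟨h1a, h1b, h1c, h1d⟩ := h.tree₁
  obtain ⟨h2a, h2b, h2c, h2d⟩ := h.tree₂
  have hvu : s(v, u) ∈ E := h.mem_edges.mpr (.inl rfl)
  have sub₁ : E₁ ⊆ E := fun e he => h.mem_edges.mpr (.inr (.inl he))
  have sub₂ : E₂ ⊆ E := fun e he => h.mem_edges.mpr (.inr (.inr he))
  have toV : ∀ a ∈ V, EReach E a v := by
    intro a ha
    rw [h.verts, Finset.mem_union] at ha
    rcases ha with ha | ha
    · exact (h1c a ha v h.mem₁).mono sub₁
    · exact ((h2c a ha u h.mem₂).mono sub₂).tail (by rwa [Sym2.eq_swap])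
  refine ⟨?_, ?_, fun a ha b hb => (toV a ha).trans (toV b hb).symm, ?_⟩
  · intro e he x hx
    rw [h.verts, Finset.mem_union]
    rcases h.mem_edges.mp he with rfl | he | he
    · rcases Sym2.mem_iff.mp hx with rfl | rfl
      · exact .inl h.mem₁
      · exact .inr h.mem₂
    · exact .inl (h1a e he x hx)
    · exact .inr (h2a e he x hx)
  · intro e he
    rcases h.mem_edges.mp he with rfl | he | he
    · rw [Sym2.mk_isDiag_iff]
      rintro rfl
      exact h.notMem₂ h.mem₁ h.mem₂
    · exact h1b e he
    · exact h2b e he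
  · have hd : Disjoint E₁ E₂ := by
      rw [Finset.disjoint_left]
      intro e he he'
      induction e using Sym2.ind with | _ p q
      exact h.notMem₂ (h.mem_of_mem₁ he).1 (h.mem_of_mem₂ he').1
    have hn : s(v, u) ∉ E₁ ∪ E₂ := by
      rw [Finset.mem_union]
      rintro (he | he)
      · exact h.notMem₁ h.mem₂ (h.mem_of_mem₁ he).2
      · exact h.notMem₂ h.mem₁ (h.mem_of_mem₂ he).1
    rw [h.verts, h.edges, Finset.card_insert_of_notMem hn, Finset.card_union_of_disjoint hd,
      Finset.card_union_of_disjoint h.disj]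
    omega

/-- The edges of `E` with an endpoint `a ≠ v` in `V₁` lie in `E₁`. -/
lemma mem_edges₁_of_mem (h : IsJoin V E v u V₁ V₂ E₁ E₂) {a b : ℕ} (ha : a ∈ V₁) (hv : v ≠ a)
    (hab : s(a, b) ∈ E) : s(a, b) ∈ E₁ := by
  rcases h.mem_edges.mp hab with he | he | he
  · rcases Sym2.eq_iff.mp he with ⟨rfl, _⟩ | ⟨rfl, _⟩
    · exact absurd rfl hv
    · exact absurd h.mem₂ (h.notMem₂ ha)
  · exact he
  · exact absurd (h.mem_of_mem₂ he).1 (h.notMem₂ ha)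

/-- The edges of `E` with an endpoint in `V₂` that avoid `v` lie in `E₂`. -/
lemma mem_edges₂_of_mem (h : IsJoin V E v u V₁ V₂ E₁ E₂) {a b : ℕ} (ha : a ∈ V₂) (hv : v ≠ b)
    (hab : s(a, b) ∈ E) : s(a, b) ∈ E₂ := by
  rcases h.mem_edges.mp hab with he | he | he
  · rcases Sym2.eq_iff.mp he with ⟨rfl, _⟩ | ⟨_, rfl⟩
    · exact absurd ha (h.notMem₂ h.mem₁)
    · exact absurd rfl hv
  · exact absurd (h.mem_of_mem₁ he).1 (h.notMem₁ ha)
  · exact he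

lemma mem_filter_of_mem₂ (h : IsJoin V E v u V₁ V₂ E₁ E₂) {a b : ℕ} (hab : s(a, b) ∈ E₂) :
    s(a, b) ∈ E.filter (v ∉ ·) := by
  simp only [Finset.mem_filter, Sym2.mem_iff, not_or]
  obtain ⟨ha, hb⟩ := h.mem_of_mem₂ hab
  exact ⟨h.mem_edges.mpr (.inr (.inr hab)), fun e => h.notMem₂ h.mem₁ (e ▸ ha),
    fun e => h.notMem₂ h.mem₁ (e ▸ hb)⟩

lemma reach₂_iff (h : IsJoin V E v u V₁ V₂ E₁ E₂) {m x : ℕ} (hm : m ∈ V₂) :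
    EReach (E.filter (v ∉ ·)) m x ↔ x ∈ V₂ := by
  constructor
  · intro hr
    refine (EReach.of_closed (F := E₂) (S := V₂) ?_ hm hr).2
    intro a ha b hab
    simp only [Finset.mem_filter, Sym2.mem_iff, not_or] at hab
    have := h.mem_edges₂_of_mem ha hab.2.2 hab.1
    exact ⟨this, (h.mem_of_mem₂ this).2⟩
  · intro hx
    refine (h.tree₂.2.2.1 m hm x hx).mono fun e he => ?_
    induction e using Sym2.ind with | _ p q
    exact h.mem_filter_of_mem₂ he

lemma reach₁_iff (h : IsJoin V E v u V₁ V₂ E₁ E₂) {m x : ℕ} (hm : m ∈ V₁) :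
    EReach (E.filter (v ∉ ·)) m x ↔ EReach (E₁.filter (v ∉ ·)) m x := by
  constructor
  · intro hr
    refine (EReach.of_closed (F := E₁.filter (v ∉ ·)) (S := V₁) ?_ hm hr).1
    intro a ha b hab
    simp only [Finset.mem_filter, Sym2.mem_iff, not_or] at hab ⊢
    have := h.mem_edges₁_of_mem ha hab.2.1 hab.1
    exact ⟨⟨this, hab.2⟩, (h.mem_of_mem₁ this).2⟩
  · exact fun hr => hr.mono
      (Finset.filter_subset_filter _ fun e he => h.mem_edges.mpr (.inr (.inl he)))

lemma reach₁_mem (h : IsJoin V E v u V₁ V₂ E₁ E₂) {m x : ℕ} (hm : m ∈ V₁)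
    (hr : EReach (E₁.filter (v ∉ ·)) m x) : x ∈ V₁ :=
  (EReach.of_closed (F := E₁) (S := V₁) (fun a _ b hab => by
    have := (Finset.mem_filter.mp hab).1
    exact ⟨this, (h.mem_of_mem₁ this).2⟩) hm hr).2

lemma edges₂_eq (h : IsJoin V E v u V₁ V₂ E₁ E₂) : E₂ = E.filter fun e => ∀ x ∈ e, x ∈ V₂ := by
  ext e
  simp only [Finset.mem_filter]
  refine ⟨fun he => ⟨h.mem_edges.mpr (.inr (.inr he)), h.tree₂.1 e he⟩, fun ⟨he, hx⟩ => ?_⟩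
  rcases h.mem_edges.mp he with rfl | he' | he'
  · exact absurd (hx v (by simp)) (h.notMem₂ h.mem₁)
  · induction e using Sym2.ind with | _ p q
    exact absurd (hx p (by simp)) (h.notMem₂ (h.mem_of_mem₁ he').1)
  · exact he'

lemma edges₁_eq (h : IsJoin V E v u V₁ V₂ E₁ E₂) : E₁ = E.filter fun e => ∀ x ∈ e, x ∈ V₁ := by
  ext e
  simp only [Finset.mem_filter]
  refine ⟨fun he => ⟨h.mem_edges.mpr (.inr (.inl he)), h.tree₁.1 e he⟩, fun ⟨he, hx⟩ => ?_⟩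
  rcases h.mem_edges.mp he with rfl | he' | he'
  · exact absurd (hx u (by simp)) (h.notMem₁ h.mem₂)
  · exact he'
  · induction e using Sym2.ind with | _ p q
    exact absurd (hx p (by simp)) (h.notMem₁ (h.mem_of_mem₂ he').1)

/-- A join is determined by the resulting tree, `v`, and one vertex of `V₂`. -/
lemma unique (h : IsJoin V E v u V₁ V₂ E₁ E₂) {u' : ℕ} {V₁' V₂' : Finset ℕ}
    {E₁' E₂' : Finset (Sym2 ℕ)} (h' : IsJoin V E v u' V₁' V₂' E₁' E₂') {m : ℕ}
    (hm : m ∈ V₂) (hm' : m ∈ V₂') : V₁ = V₁' ∧ V₂ = V₂' ∧ E₁ = E₁' ∧ E₂ = E₂' := by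
  have h2 : V₂ = V₂' := by
    ext x
    rw [← h.reach₂_iff hm, h'.reach₂_iff hm']
  have h1 : V₁ = V₁' := by
    rw [← Finset.union_sdiff_cancel_right h.disj, ← Finset.union_sdiff_cancel_right h'.disj,
      ← h.verts, ← h'.verts, h2]
  refine ⟨h1, h2, ?_, ?_⟩
  · rw [h.edges₁_eq, h'.edges₁_eq, h1]
  · rw [h.edges₂_eq, h'.edges₂_eq, h2]

end IsJoin

/-- A tree can be cut along the first edge of the path from `v` to another vertex `m`. -/
lemma exists_isJoin {V : Finset ℕ} {E : Finset (Sym2 ℕ)} (hT : IsTreeOn V E) {v m : ℕ}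
    (hv : v ∈ V) (hm : m ∈ V) (hmv : m ≠ v) :
    ∃ u V₁ V₂ E₁ E₂, IsJoin V E v u V₁ V₂ E₁ E₂ ∧ m ∈ V₂ := by
  obtain ⟨hmem, hdiag, hconn, hcard⟩ := hT
  have hmem' : ∀ {a b}, s(a, b) ∈ E → a ∈ V ∧ b ∈ V := fun hab =>
    ⟨hmem _ hab _ (by simp), hmem _ hab _ (by simp)⟩
  set V₂ := V.filter fun x => EReach (E.filter (v ∉ ·)) m x with hV₂
  set V₁ := V \ V₂ with hV₁
  set E₁ := E.filter fun e => ∀ x ∈ e, x ∈ V₁ with hE₁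
  set E₂ := E.filter fun e => ∀ x ∈ e, x ∈ V₂ with hE₂
  have hmV₂ : m ∈ V₂ := by simp [hV₂, hm, EReach, Relation.ReflTransGen.refl]
  have hvV₂ : v ∉ V₂ := by
    intro h
    have := (EReach.of_closed (F := E) (S := V.erase v) (fun a _ b hab => by
      simp only [Finset.mem_filter, Sym2.mem_iff, not_or] at hab
      exact ⟨hab.1, Finset.mem_erase.mpr ⟨Ne.symm hab.2.2, (hmem' hab.1).2⟩⟩)
      (Finset.mem_erase.mpr ⟨hmv, hm⟩) (Finset.mem_filter.mp h).2).2
    simp at this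
  have hvV₁ : v ∈ V₁ := by simp [hV₁, hv, hvV₂]
  have hdisj : Disjoint V₁ V₂ := Finset.sdiff_disjoint
  have step : ∀ a ∈ V₂, ∀ b, s(a, b) ∈ E → b ≠ v → b ∈ V₂ := by
    intro a ha b hab hb
    have hav : a ≠ v := fun h => hvV₂ (h ▸ ha)
    refine Finset.mem_filter.mpr ⟨(hmem' hab).2, (Finset.mem_filter.mp ha).2.tail ?_⟩
    simp [hab, hav.symm, hb.symm]
  obtain ⟨u, hu, hvu⟩ : ∃ u ∈ V₂, s(v, u) ∈ E := by
    by_contra! hno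
    refine hvV₂ (EReach.of_closed (F := E) (S := V₂) (fun a ha b hab => ⟨hab, step a ha b hab ?_⟩)
      hmV₂ (hconn m hm v hv)).2
    rintro rfl
    exact hno a ha (by rwa [Sym2.eq_swap])
  have conn₁ : ∀ x ∈ V₁, EReach E₁ v x := by
    have key : ∀ x, EReach E v x → x ∈ V₂ ∨ (x ∈ V₁ ∧ EReach E₁ v x) := by
      intro x hx
      induction hx with
      | refl => exact .inr ⟨hvV₁, .refl⟩
      | @tail b c _ hbc ih =>
        by_cases hc : c ∈ V₂
        · exact .inl hc
        have hcV₁ : c ∈ V₁ := by simp [hV₁, hc, (hmem' hbc).2]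
        rcases ih with hb | ⟨hb, hvb⟩
        · by_cases hcv : c = v
          · subst hcv
            exact .inr ⟨hvV₁, .refl⟩
          · exact absurd (step b hb c hbc hcv) hc
        · exact .inr ⟨hcV₁, hvb.tail (by simp [hE₁, hbc, hb, hcV₁])⟩
    intro x hx
    rcases key x (hconn v hv x (Finset.mem_sdiff.mp hx).1) with h | h
    · exact absurd h (Finset.mem_sdiff.mp hx).2
    · exact h.2
  have conn₂ : ∀ x ∈ V₂, EReach E₂ m x := by
    intro x hx
    refine (EReach.of_closed (S := V₂) (fun a ha b hab => ?_) hmV₂ (Finset.mem_filter.mp hx).2).1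
    simp only [Finset.mem_filter, Sym2.mem_iff, not_or] at hab
    have hb := step a ha b hab.1 (Ne.symm hab.2.2)
    exact ⟨by simp [hE₂, hab.1, ha, hb], hb⟩
  have c₁ := card_le_of_reach E₁ V₁ {v} (by simpa using conn₁)
  have c₂ := card_le_of_reach E₂ V₂ {m} (by simpa using conn₂)
  simp only [Finset.card_singleton] at c₁ c₂
  have hVe : V = V₁ ∪ V₂ := (Finset.sdiff_union_of_subset (Finset.filter_subset _ _)).symm
  have cV : V.card = V₁.card + V₂.card := by
    rw [← Finset.card_union_of_disjoint hdisj, ← hVe]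
  have hd : Disjoint E₁ E₂ := by
    rw [Finset.disjoint_left]
    intro e he he'
    induction e using Sym2.ind with | _ p q
    exact Finset.disjoint_left.mp hdisj ((Finset.mem_filter.mp he).2 p (by simp))
      ((Finset.mem_filter.mp he').2 p (by simp))
  have hn : s(v, u) ∉ E₁ ∪ E₂ := by
    rw [Finset.mem_union]
    rintro (he | he)
    · exact Finset.disjoint_right.mp hdisj hu ((Finset.mem_filter.mp he).2 u (by simp))
    · exact hvV₂ ((Finset.mem_filter.mp he).2 v (by simp))
  have hsub : insert s(v, u) (E₁ ∪ E₂) ⊆ E :=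
    Finset.insert_subset hvu (Finset.union_subset (Finset.filter_subset _ _)
      (Finset.filter_subset _ _))
  have ci : (insert s(v, u) (E₁ ∪ E₂)).card = E₁.card + E₂.card + 1 := by
    rw [Finset.card_insert_of_notMem hn, Finset.card_union_of_disjoint hd]
  have cs := Finset.card_le_card hsub
  refine ⟨u, V₁, V₂, E₁, E₂, ⟨⟨?_, ?_, ?_, by omega⟩, ⟨?_, ?_, ?_, by omega⟩, hdisj, hvV₁, hu, hVe,
    (Finset.eq_of_subset_of_card_le hsub (by omega)).symm⟩, hmV₂⟩
  · exact fun e he => (Finset.mem_filter.mp he).2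
  · exact fun e he => hdiag e (Finset.mem_filter.mp he).1
  · exact fun a ha b hb => (conn₁ a ha).symm.trans (conn₁ b hb)
  · exact fun e he => (Finset.mem_filter.mp he).2
  · exact fun e he => hdiag e (Finset.mem_filter.mp he).1
  · exact fun a ha b hb => (conn₂ a ha).symm.trans (conn₂ b hb)

/-! ### The weight of a join -/

/-- The vertex set of the component of `u` after deleting `v`. -/
noncomputable def deletionComponent (V : Finset ℕ) (E : Finset (Sym2 ℕ)) (v u : ℕ) : Finset ℕ :=
  (V.erase v).filter fun x => EReach (E.filter (v ∉ ·)) u x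

lemma treeWeightAux_eq_of_card_le (t : ℕ → ℕ) (f : ℕ) :
    ∀ (f' : ℕ) (V : Finset ℕ) (E : Finset (Sym2 ℕ)), V.card ≤ f → V.card ≤ f' →
      treeWeightAux t f V E = treeWeightAux t f' V E := by
  induction f with
  | zero =>
    intro f' V E h _
    cases f' with
    | zero => rfl
    | succ f' => rw [treeWeightAux, treeWeightAux, dif_neg (by omega)]
  | succ f ih =>
    intro f' V E h h'
    cases f' with
    | zero => rw [treeWeightAux, treeWeightAux, dif_neg (by omega)]
    | succ f' =>
      rw [treeWeightAux, treeWeightAux]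
      by_cases hc : 2 ≤ V.card
      · rw [dif_pos hc, dif_pos hc]
        refine Finset.sum_congr rfl fun u _ => ?_
        have hlt : ((V.erase (V.min' (Finset.card_pos.mp (by omega)))).filter fun x =>
            EReach (E.filter fun e => V.min' (Finset.card_pos.mp (by omega)) ∉ e) u x).card
              < V.card :=
          (Finset.card_filter_le _ _).trans_lt (Finset.card_erase_lt_of_mem (Finset.min'_mem _ _))
        exact congrArg _ (ih _ _ _ (by omega) (by omega))
      · rw [dif_neg hc, dif_neg hc]

lemma treeWeight_eq_sum {V : Finset ℕ} (E : Finset (Sym2 ℕ)) (t : ℕ → ℕ) {v : ℕ} (hv : v ∈ V)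
    (hmin : ∀ x ∈ V, v ≤ x) :
    treeWeight V E t = ∑ u ∈ (V.erase v).filter (fun u => s(v, u) ∈ E),
      (((deletionComponent V E v u).filter fun x => t v < t x ∧ x < u).card +
        treeWeight (deletionComponent V E v u)
          ((E.filter (v ∉ ·)).filter fun e => ∀ x ∈ e, x ∈ deletionComponent V E v u) t) := by
  have hpos : 0 < V.card := Finset.card_pos.mpr ⟨v, hv⟩
  by_cases hc : 2 ≤ V.card
  · have hvm : V.min' ⟨v, hv⟩ = v :=
      le_antisymm (Finset.min'_le _ _ hv) (Finset.le_min' _ _ _ hmin)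
    obtain ⟨f, hf⟩ : ∃ f, V.card = f + 1 := ⟨V.card - 1, by omega⟩
    rw [treeWeight, hf, treeWeightAux, dif_pos hc]
    simp only [hvm]
    refine Finset.sum_congr rfl fun u _ => congrArg _ ?_
    have hlt : (deletionComponent V E v u).card < V.card :=
      (Finset.card_filter_le _ _).trans_lt (Finset.card_erase_lt_of_mem hv)
    exact treeWeightAux_eq_of_card_le _ _ _ _ _ (by unfold deletionComponent at hlt; omega) le_rfl
  · have h1 : V.card = 1 := by omega
    have : V.erase v = ∅ := by
      rw [← Finset.card_eq_zero, Finset.card_erase_of_mem hv, h1]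
    rw [this, Finset.filter_empty, Finset.sum_empty, treeWeight, h1, treeWeightAux,
      dif_neg hc]

/-- The weight of a join of two trees, when the minimal vertex is an end of the added edge. -/
lemma IsJoin.treeWeight_eq {V : Finset ℕ} {E : Finset (Sym2 ℕ)} {v u : ℕ} {V₁ V₂ : Finset ℕ}
    {E₁ E₂ : Finset (Sym2 ℕ)} (h : IsJoin V E v u V₁ V₂ E₁ E₂) (hmin : ∀ x ∈ V, v ≤ x)
    (t : ℕ → ℕ) :
    treeWeight V E t = (V₂.filter fun x => t v < t x ∧ x < u).card + treeWeight V₂ E₂ t +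
      treeWeight V₁ E₁ t := by
  have hvV : v ∈ V := by rw [h.verts]; exact Finset.mem_union_left _ h.mem₁
  have hnbr : (V.erase v).filter (fun x => s(v, x) ∈ E) =
      insert u ((V₁.erase v).filter fun x => s(v, x) ∈ E₁) := by
    ext x
    simp only [Finset.mem_filter, Finset.mem_erase, Finset.mem_insert, h.verts, Finset.mem_union]
    constructor
    · rintro ⟨⟨hxv, hx⟩, hvx⟩
      rcases h.mem_edges.mp hvx with he | he | he
      · rcases Sym2.eq_iff.mp he with ⟨_, rfl⟩ | ⟨_, rfl⟩
        · exact .inl rfl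
        · exact absurd rfl hxv
      · exact .inr ⟨⟨hxv, (h.mem_of_mem₁ he).2⟩, he⟩
      · exact absurd (h.mem_of_mem₂ he).1 (h.notMem₂ h.mem₁)
    · rintro (rfl | ⟨⟨hxv, hx⟩, he⟩)
      · exact ⟨⟨fun e => h.notMem₂ h.mem₁ (e ▸ h.mem₂), .inr h.mem₂⟩, h.mem_edges.mpr (.inl rfl)⟩
      · exact ⟨⟨hxv, .inl hx⟩, h.mem_edges.mpr (.inr (.inl he))⟩
  have hu : u ∉ (V₁.erase v).filter fun x => s(v, x) ∈ E₁ := fun hu =>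
    h.notMem₁ h.mem₂ (Finset.mem_of_mem_erase (Finset.mem_filter.mp hu).1)
  have hC₂ : deletionComponent V E v u = V₂ := by
    ext x
    rw [deletionComponent, Finset.mem_filter, h.reach₂_iff h.mem₂, h.verts]
    simp only [Finset.mem_erase, Finset.mem_union]
    exact ⟨fun hx => hx.2, fun hx => ⟨⟨fun e => h.notMem₂ h.mem₁ (e ▸ hx), .inr hx⟩, hx⟩⟩
  have hC₁ : ∀ x ∈ V₁, deletionComponent V E v x = deletionComponent V₁ E₁ v x := by
    intro x hx
    ext y
    rw [deletionComponent, deletionComponent, Finset.mem_filter, Finset.mem_filter,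
      h.reach₁_iff hx, h.verts]
    simp only [Finset.mem_erase, Finset.mem_union]
    exact ⟨fun hy => ⟨⟨hy.1.1, h.reach₁_mem hx hy.2⟩, hy.2⟩,
      fun hy => ⟨⟨hy.1.1, .inl hy.1.2⟩, hy.2⟩⟩
  have hmin₁ : ∀ x ∈ V₁, v ≤ x := fun x hx =>
    hmin x (by rw [h.verts]; exact Finset.mem_union_left _ hx)
  rw [treeWeight_eq_sum E t hvV hmin, treeWeight_eq_sum E₁ t h.mem₁ hmin₁, hnbr,
    Finset.sum_insert hu, hC₂]
  congr 1
  · congr 2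
    rw [h.edges₂_eq]
    ext e
    simp only [Finset.mem_filter]
    exact ⟨fun he => ⟨he.1.1, he.2⟩,
      fun he => ⟨⟨he.1, fun hve => h.notMem₂ h.mem₁ (he.2 v hve)⟩, he.2⟩⟩
  · refine Finset.sum_congr rfl fun x hx => ?_
    have hxV₁ := Finset.mem_of_mem_erase (Finset.mem_filter.mp hx).1
    rw [hC₁ x hxV₁]
    congr 2
    ext e
    simp only [Finset.mem_filter]
    have hsub : (∀ y ∈ e, y ∈ deletionComponent V₁ E₁ v x) → ∀ y ∈ e, y ∈ V₁ := fun hy y hye =>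
      Finset.mem_of_mem_erase (Finset.mem_filter.mp (hy y hye)).1
    refine and_congr_left fun he => and_congr_left fun _ => ?_
    rw [h.edges₁_eq, Finset.mem_filter]
    exact ⟨fun h' => ⟨h', hsub he⟩, fun h' => h'.1⟩

/-! ### Weight zero trees from increasing binary trees -/

lemma treeWeight_singleton (v : ℕ) (E : Finset (Sym2 ℕ)) (t : ℕ → ℕ) :
    treeWeight {v} E t = 0 := by
  rw [treeWeight_eq_sum E t (Finset.mem_singleton_self v) (by simp)]
  simp

lemma isTreeOn_singleton (v : ℕ) : IsTreeOn {v} ∅ := by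
  refine ⟨by simp, by simp, ?_, by simp⟩
  intro a ha b hb
  rw [Finset.mem_singleton.mp ha, Finset.mem_singleton.mp hb]
  exact .refl

lemma IsTreeOn.eq_empty_of_singleton {v : ℕ} {E : Finset (Sym2 ℕ)} (h : IsTreeOn {v} E) :
    E = ∅ := by
  simpa using h.2.2.2

lemma IsTreeOn.exists_neighbor {V : Finset ℕ} {E : Finset (Sym2 ℕ)} (h : IsTreeOn V E) {v w : ℕ}
    (hv : v ∈ V) (hw : w ∈ V) (hvw : v ≠ w) : ∃ x ∈ V, x ≠ v ∧ s(v, x) ∈ E := by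
  rcases Relation.ReflTransGen.cases_head (h.2.2.1 v hv w hw) with h' | ⟨c, hc, _⟩
  · exact absurd h' hvw
  · refine ⟨c, h.1 _ hc c (by simp), ?_, hc⟩
    rintro rfl
    exact h.2.1 _ hc (by simp)

lemma IsJoin.isTieredOn_iff {V : Finset ℕ} {E : Finset (Sym2 ℕ)} {v u : ℕ} {V₁ V₂ : Finset ℕ}
    {E₁ E₂ : Finset (Sym2 ℕ)} (h : IsJoin V E v u V₁ V₂ E₁ E₂) (hvu : v < u) (k : ℕ)
    (t : ℕ → ℕ) :
    IsTieredOn V E k t ↔ IsTieredOn V₁ E₁ k t ∧ IsTieredOn V₂ E₂ k t ∧ t v < t u := by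
  simp only [IsTieredOn, h.verts, Finset.mem_union, h.mem_edges]
  constructor
  · rintro ⟨h1, h2⟩
    exact ⟨⟨fun x hx => h1 x (.inl hx), fun a b hab => h2 a b (.inr (.inl hab))⟩,
      ⟨fun x hx => h1 x (.inr hx), fun a b hab => h2 a b (.inr (.inr hab))⟩,
      h2 v u (.inl rfl) hvu⟩
  · rintro ⟨⟨h1, h1'⟩, ⟨h2, h2'⟩, h3⟩
    refine ⟨fun x hx => hx.elim (h1 x) (h2 x), ?_⟩
    rintro a b (hab | hab | hab) hlt
    · rcases Sym2.eq_iff.mp hab with ⟨rfl, rfl⟩ | ⟨rfl, rfl⟩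
      · exact h3
      · omega
    · exact h1' a b hab hlt
    · exact h2' a b hab hlt

lemma descCount_append_cons {m : ℕ} (L R : List ℕ) (hL : ∀ x ∈ L, m < x)
    (hR : ∀ x ∈ R, m < x) :
    descCount (L ++ m :: R) = descCount L + (if L = [] then 0 else 1) + descCount R := by
  have hmR : descCount (m :: R) = descCount R := by
    cases R with
    | nil => rfl
    | cons b R =>
      rw [descCount, if_neg (by have := hR b (by simp); omega), zero_add]
  induction L with
  | nil => simp [hmR, descCount]
  | cons a L ih =>
    cases L with
    | nil =>
      have := hL a (by simp)
      simp [descCount, hmR, this]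
    | cons b L =>
      have := ih fun x hx => hL x (by simp [hx])
      simp only [List.cons_append, descCount, reduceCtorEq, if_false] at this ⊢
      omega

namespace BinaryTree

/-- The labels of a binary tree. -/
def labels : BinaryTree ℕ → Finset ℕ
  | nil => ∅
  | node m l r => insert m (l.labels ∪ r.labels)

/-- Labels are distinct and increase away from the root. -/
def IsIncreasing : BinaryTree ℕ → Prop
  | nil => True
  | node m l r => (∀ x ∈ l.labels, m < x) ∧ (∀ x ∈ r.labels, m < x) ∧
      Disjoint l.labels r.labels ∧ l.IsIncreasing ∧ r.IsIncreasing

/-- The vertices on tier `2` of the tree encoded by a binary tree; see `BinaryTree.edges`. -/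
def maxima : BinaryTree ℕ → Finset ℕ
  | nil => ∅
  | node m l r => l.maxima ∪ if r.maxima = ∅ then {m} else r.maxima

/-- The maxima contributed by a node labelled `m` together with its right subtree `r`. -/
def branchMaxima (m : ℕ) (r : BinaryTree ℕ) : Finset ℕ :=
  if r.maxima = ∅ then {m} else r.maxima

/-- The tree with minimal vertex `v` encoded by a binary tree: a node `m` with its right subtree
encodes one component left after deleting `v` (the one with minimal vertex `m`), joined to `v`
at its smallest maximum; the left subtree encodes the other components. -/
noncomputable def edges (v : ℕ) : BinaryTree ℕ → Finset (Sym2 ℕ)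
  | nil => ∅
  | node m l r =>
    insert s(v, sInf (branchMaxima m r : Set ℕ)) (l.edges v ∪ r.edges m)

/-- The inorder reading word. -/
def inorder : BinaryTree ℕ → List ℕ
  | nil => []
  | node m l r => l.inorder ++ m :: r.inorder

lemma maxima_node (m : ℕ) (l r : BinaryTree ℕ) :
    (node m l r).maxima = l.maxima ∪ branchMaxima m r := rfl

lemma maxima_subset (b : BinaryTree ℕ) : b.maxima ⊆ b.labels := by
  induction b with
  | nil => simp [maxima]
  | node m l r hl hr =>
    rw [maxima, labels]
    intro x hx
    rcases Finset.mem_union.mp hx with hx | hx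
    · simp [hl hx]
    · split_ifs at hx
      · simp [Finset.mem_singleton.mp hx]
      · simp [hr hx]

lemma maxima_eq_empty_iff (b : BinaryTree ℕ) : b.maxima = ∅ ↔ b = nil := by
  cases b with
  | nil => simp [maxima]
  | node m l r =>
    simp only [maxima, Finset.union_eq_empty, reduceCtorEq, iff_false, not_and]
    intro _
    split_ifs with h
    · simp
    · exact h

lemma labels_eq_empty_iff (b : BinaryTree ℕ) : b.labels = ∅ ↔ b = nil := by
  cases b <;> simp [labels]

lemma branchMaxima_nil (m : ℕ) : branchMaxima m nil = {m} := by
  simp [branchMaxima, maxima]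

lemma branchMaxima_of_ne_nil (m : ℕ) {r : BinaryTree ℕ} (h : r ≠ nil) :
    branchMaxima m r = r.maxima :=
  if_neg ((maxima_eq_empty_iff r).not.mpr h)

lemma branchMaxima_nonempty (m : ℕ) (r : BinaryTree ℕ) : (branchMaxima m r).Nonempty := by
  unfold branchMaxima
  split_ifs with h
  · simp
  · exact Finset.nonempty_iff_ne_empty.mpr h

lemma branchMaxima_subset (m : ℕ) (r : BinaryTree ℕ) : branchMaxima m r ⊆ insert m r.labels := by
  unfold branchMaxima
  split_ifs with h
  · simp
  · exact (maxima_subset r).trans (Finset.subset_insert _ _)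

lemma sInf_branchMaxima_mem (m : ℕ) (r : BinaryTree ℕ) :
    sInf (branchMaxima m r : Set ℕ) ∈ branchMaxima m r :=
  Finset.mem_coe.mp (Nat.sInf_mem (Finset.coe_nonempty.mpr (branchMaxima_nonempty m r)))

/-- The two parts of the vertex set encoded by a node are disjoint. -/
lemma IsIncreasing.disjoint_parts {m : ℕ} {l r : BinaryTree ℕ} (h : (node m l r).IsIncreasing)
    {v : ℕ} (hv : ∀ x ∈ (node m l r).labels, v < x) :
    Disjoint (insert v l.labels) (insert m r.labels) := by
  obtain ⟨h1, -, h3, -⟩ := h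
  have hvm := hv m (by simp [labels])
  rw [Finset.disjoint_insert_left, Finset.disjoint_insert_right, Finset.mem_insert]
  refine ⟨?_, fun hm => (h1 m hm).false, h3⟩
  rintro (rfl | hr)
  · exact hvm.false
  · exact (hv v (by simp [labels, hr])).false

lemma IsIncreasing.isTreeOn {b : BinaryTree ℕ} (h : b.IsIncreasing) {v : ℕ}
    (hv : ∀ x ∈ b.labels, v < x) : IsTreeOn (insert v b.labels) (b.edges v) := by
  induction b generalizing v with
  | nil => exact isTreeOn_singleton v
  | node m l r hl hr =>
    have hd := h.disjoint_parts hv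
    obtain ⟨h1, h2, h3, h4, h5⟩ := h
    exact (IsJoin.mk (hl h4 fun x hx => hv x (by simp [labels, hx])) (hr h5 h2) hd
      (Finset.mem_insert_self _ _) (branchMaxima_subset _ _ (sInf_branchMaxima_mem m r))
      (by ext; simp [labels]; tauto) rfl).isTreeOn

lemma IsIncreasing.isJoin {m : ℕ} {l r : BinaryTree ℕ} (h : (node m l r).IsIncreasing) {v : ℕ}
    (hv : ∀ x ∈ (node m l r).labels, v < x) :
    IsJoin (insert v (node m l r).labels) ((node m l r).edges v) v
      (sInf (branchMaxima m r : Set ℕ)) (insert v l.labels) (insert m r.labels)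
      (l.edges v) (r.edges m) where
  tree₁ := h.2.2.2.1.isTreeOn fun x hx => hv x (by simp [labels, hx])
  tree₂ := h.2.2.2.2.isTreeOn h.2.1
  disj := h.disjoint_parts hv
  mem₁ := Finset.mem_insert_self _ _
  mem₂ := branchMaxima_subset _ _ (sInf_branchMaxima_mem m r)
  verts := by ext; simp [labels]; tauto
  edges := rfl

lemma IsIncreasing.isTieredOn_and_treeWeight_eq_zero {b : BinaryTree ℕ} (h : b.IsIncreasing)
    {v : ℕ} (hv : ∀ x ∈ b.labels, v < x) {t : ℕ → ℕ}
    (ht : ∀ x ∈ insert v b.labels, t x = if x ∈ b.maxima then 2 else 1) :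
    IsTieredOn (insert v b.labels) (b.edges v) 2 t ∧
      treeWeight (insert v b.labels) (b.edges v) t = 0 := by
  induction b generalizing v with
  | nil =>
    refine ⟨⟨fun x hx => ?_, by simp [edges]⟩, treeWeight_singleton v _ t⟩
    rw [ht x hx]
    simp [maxima]
  | node m l r hl hr =>
    have hJ := h.isJoin hv
    obtain ⟨h1, h2, h3, h4, h5⟩ := h
    set u := sInf (branchMaxima m r : Set ℕ) with hu
    have hub : u ∈ branchMaxima m r := sInf_branchMaxima_mem m r
    have ht₁ : ∀ x ∈ insert v l.labels, t x = if x ∈ l.maxima then 2 else 1 := by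
      intro x hx
      have hxb : x ∉ branchMaxima m r := fun hxb => hJ.notMem₂ hx (branchMaxima_subset _ _ hxb)
      rw [ht x (hJ.verts ▸ Finset.mem_union_left _ hx), maxima_node]
      simp [hxb]
    have ht₂ : ∀ x ∈ insert m r.labels, t x = if x ∈ branchMaxima m r then 2 else 1 := by
      intro x hx
      have hxl : x ∉ l.maxima := fun hxl =>
        hJ.notMem₁ hx (Finset.mem_insert_of_mem (maxima_subset _ hxl))
      rw [ht x (hJ.verts ▸ Finset.mem_union_right _ hx), maxima_node]
      simp [hxl]
    have htv : t v = 1 := by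
      rw [ht₁ v (Finset.mem_insert_self _ _), if_neg]
      exact fun hvl => (hv v (by simp [labels, maxima_subset _ hvl])).false
    have htu : t u = 2 := by rw [ht₂ u hJ.mem₂, if_pos hub]
    have hvu : v < u := hv u (by
      have := branchMaxima_subset _ _ hub
      rw [Finset.mem_insert] at this
      rw [labels, Finset.mem_insert, Finset.mem_union]
      tauto)
    have hl' := hl h4 (fun x hx => hv x (by simp [labels, hx])) ht₁
    have hr' : IsTieredOn (insert m r.labels) (r.edges m) 2 t ∧
        treeWeight (insert m r.labels) (r.edges m) t = 0 := by
      by_cases hrn : r = nil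
      · subst hrn
        refine ⟨⟨fun x hx => ?_, by simp [edges]⟩, treeWeight_singleton m _ t⟩
        rw [ht₂ x hx]
        split_ifs <;> simp
      · exact hr h5 h2 fun x hx => by rw [ht₂ x hx, branchMaxima_of_ne_nil m hrn]
    refine ⟨(hJ.isTieredOn_iff hvu 2 t).mpr ⟨hl'.1, hr'.1, by omega⟩, ?_⟩
    rw [hJ.treeWeight_eq (by
      intro x hx
      rcases Finset.mem_insert.mp hx with rfl | hx
      · exact le_rfl
      · exact (hv x hx).le), hl'.2, hr'.2, add_zero, add_zero, Finset.card_eq_zero,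
      Finset.filter_eq_empty_iff]
    rintro x hx ⟨hx1, hx2⟩
    rw [ht₂ x hx] at hx1
    split_ifs at hx1 with hxb
    · exact absurd (Nat.sInf_le (Finset.mem_coe.mpr hxb)) (by omega)
    · omega

/-- The minimum of the labels is the label of the root. -/
lemma IsIncreasing.root_eq {m m' : ℕ} {l r l' r' : BinaryTree ℕ}
    (h : (node m l r).IsIncreasing) (h' : (node m' l' r').IsIncreasing)
    (hL : (node m l r).labels = (node m' l' r').labels) : m = m' := by
  have le : ∀ {m : ℕ} {l r : BinaryTree ℕ}, (node m l r).IsIncreasing →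
      ∀ x ∈ (node m l r).labels, m ≤ x := by
    intro m l r h x hx
    rw [labels, Finset.mem_insert, Finset.mem_union] at hx
    rcases hx with rfl | hx | hx
    · exact le_rfl
    · exact (h.1 x hx).le
    · exact (h.2.1 x hx).le
  exact le_antisymm (le h _ (hL ▸ by simp [labels])) (le h' _ (hL ▸ by simp [labels]))

lemma IsIncreasing.eq_of_edges_eq {b b' : BinaryTree ℕ} (h : b.IsIncreasing)
    (h' : b'.IsIncreasing) (hL : b.labels = b'.labels) {v : ℕ} (hv : ∀ x ∈ b.labels, v < x)
    (hE : b.edges v = b'.edges v) : b = b' := by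
  induction b generalizing v b' with
  | nil => exact ((labels_eq_empty_iff b').mp (hL ▸ rfl)).symm
  | node m l r hl hr =>
    cases b' with
    | nil => simp [labels] at hL
    | node m' l' r' =>
      obtain rfl := h.root_eq h' hL
      have hJ := h.isJoin hv
      have hJ' := h'.isJoin (hL ▸ hv)
      rw [← hE, ← hL] at hJ'
      obtain ⟨e1, e2, e3, e4⟩ := hJ.unique hJ' (Finset.mem_insert_self _ _)
        (Finset.mem_insert_self _ _)
      have hvl : ∀ x ∈ l.labels, v < x := fun x hx => hv x (by simp [labels, hx])
      have hvl' : ∀ x ∈ l'.labels, v < x := fun x hx => hv x (hL ▸ by simp [labels, hx])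
      have cancel : ∀ {a : ℕ} {s s' : Finset ℕ}, (∀ x ∈ s, a < x) → (∀ x ∈ s', a < x) →
          insert a s = insert a s' → s = s' := by
        intro a s s' hs hs' e
        rw [← Finset.erase_insert (fun ha => (hs a ha).false), e,
          Finset.erase_insert (fun ha => (hs' a ha).false)]
      rw [hl h.2.2.2.1 h'.2.2.2.1 (cancel hvl hvl' e1) hvl e3,
        hr h.2.2.2.2 h'.2.2.2.2 (cancel h.2.1 h'.2.1 e2) h.2.1 e4]

/-- Every weight zero tree with tiers `1` and `2` comes from an increasing binary tree. -/
lemma exists_isIncreasing_of_treeWeight_eq_zero {V : Finset ℕ} {E : Finset (Sym2 ℕ)}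
    {t : ℕ → ℕ} {v : ℕ} (hT : IsTreeOn V E) (ht : IsTieredOn V E 2 t)
    (hw : treeWeight V E t = 0) (hv : v ∈ V) (hmin : ∀ x ∈ V, v ≤ x) (htv : t v = 1) :
    ∃ b : BinaryTree ℕ, b.IsIncreasing ∧ b.labels = V.erase v ∧ b.edges v = E ∧
      ∀ x ∈ V, t x = 2 ↔ x ∈ b.maxima := by
  induction hc : V.card using Nat.strong_induction_on generalizing V E v with
  | _ c ih =>
  subst hc
  rcases (V.erase v).eq_empty_or_nonempty with he | he
  · have hV : V = {v} := by rw [← Finset.insert_erase hv, he]; rfl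
    subst hV
    refine ⟨nil, trivial, he.symm, hT.eq_empty_of_singleton.symm, ?_⟩
    simp [maxima, htv]
  obtain ⟨hmv, hm⟩ := Finset.mem_erase.mp (Finset.min'_mem _ he)
  have hmmin : ∀ x ∈ V, x ≠ v → (V.erase v).min' he ≤ x := fun x hx hxv =>
    Finset.min'_le _ _ (Finset.mem_erase.mpr ⟨hxv, hx⟩)
  set m := (V.erase v).min' he
  obtain ⟨u, V₁, V₂, E₁, E₂, hJ, hmV₂⟩ := exists_isJoin hT hv hm hmv
  have sub₁ : ∀ {x}, x ∈ V₁ → x ∈ V := fun hx => hJ.verts ▸ Finset.mem_union_left _ hx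
  have sub₂ : ∀ {x}, x ∈ V₂ → x ∈ V := fun hx => hJ.verts ▸ Finset.mem_union_right _ hx
  have ne₂ : ∀ {x}, x ∈ V₂ → x ≠ v := fun hx e => hJ.notMem₂ hJ.mem₁ (e ▸ hx)
  have hcard : V.card = V₁.card + V₂.card := by
    rw [hJ.verts, Finset.card_union_of_disjoint hJ.disj]
  have hc₁ : 0 < V₁.card := Finset.card_pos.mpr ⟨v, hJ.mem₁⟩
  have hc₂ : 0 < V₂.card := Finset.card_pos.mpr ⟨u, hJ.mem₂⟩
  have hvu : v < u := lt_of_le_of_ne (hmin u (sub₂ hJ.mem₂)) (ne₂ hJ.mem₂).symm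
  obtain ⟨ht₁, ht₂, htvu⟩ := (hJ.isTieredOn_iff hvu 2 t).mp ht
  have htu : t u = 2 := by
    have := Finset.mem_Icc.mp (ht.1 u (sub₂ hJ.mem₂))
    omega
  rw [hJ.treeWeight_eq hmin] at hw
  have hu_min : ∀ x ∈ V₂, t x = 2 → u ≤ x := by
    intro x hx hx2
    by_contra! hlt
    have : (V₂.filter fun x => t v < t x ∧ x < u) = ∅ := Finset.card_eq_zero.mp (by omega)
    exact absurd ⟨by omega, hlt⟩ (Finset.filter_eq_empty_iff.mp this hx)
  obtain ⟨l, hl1, hl2, hl3, hl4⟩ := ih _ (by omega) hJ.tree₁ ht₁ (by omega) hJ.mem₁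
    (fun x hx => hmin x (sub₁ hx)) htv rfl
  have hm₂ : ∀ x ∈ V₂, m ≤ x := fun x hx => hmmin x (sub₂ hx) (ne₂ hx)
  obtain ⟨r, hr1, hr2, hr3, hr4⟩ : ∃ r : BinaryTree ℕ, r.IsIncreasing ∧ r.labels = V₂.erase m ∧
      r.edges m = E₂ ∧ ∀ x ∈ V₂, t x = 2 ↔ x ∈ branchMaxima m r := by
    rcases (V₂.erase m).eq_empty_or_nonempty with he₂ | ⟨w, hw₂⟩
    · have hV₂ : V₂ = {m} := by rw [← Finset.insert_erase hmV₂, he₂]; rfl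
      have hE₂ : E₂ = ∅ := (hV₂ ▸ hJ.tree₂).eq_empty_of_singleton
      have hum : u = m := Finset.mem_singleton.mp (hV₂ ▸ hJ.mem₂)
      refine ⟨nil, trivial, he₂.symm, hE₂.symm, ?_⟩
      simp [branchMaxima_nil, hV₂, ← hum, htu]
    · obtain ⟨hwm, hwV₂⟩ := Finset.mem_erase.mp hw₂
      obtain ⟨x, hx, hxm, hmx⟩ := hJ.tree₂.exists_neighbor hmV₂ hwV₂ hwm.symm
      have h1 := ht₂.2 m x hmx (lt_of_le_of_ne (hm₂ x hx) hxm.symm)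
      have h2 := Finset.mem_Icc.mp (ht₂.1 x hx)
      have h3 := Finset.mem_Icc.mp (ht₂.1 m hmV₂)
      obtain ⟨r, hr1, hr2, hr3, hr4⟩ := ih _ (by omega) hJ.tree₂ ht₂ (by omega) hmV₂ hm₂
        (by omega) rfl
      have hrn : r ≠ nil := fun hrn => by
        rw [hrn] at hr2
        exact absurd hw₂ (hr2 ▸ Finset.notMem_empty w)
      exact ⟨r, hr1, hr2, hr3, by rwa [branchMaxima_of_ne_nil m hrn]⟩
  have hbsub : ∀ x ∈ branchMaxima m r, x ∈ V₂ := by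
    intro x hx
    have := branchMaxima_subset _ _ hx
    rwa [hr2, Finset.insert_erase hmV₂] at this
  have hu : sInf (branchMaxima m r : Set ℕ) = u := by
    have hub := sInf_branchMaxima_mem m r
    refine le_antisymm (Nat.sInf_le (Finset.mem_coe.mpr ((hr4 u hJ.mem₂).mp htu))) ?_
    exact hu_min _ (hbsub _ hub) ((hr4 _ (hbsub _ hub)).mpr hub)
  refine ⟨node m l r, ⟨?_, ?_, ?_, hl1, hr1⟩, ?_, ?_, ?_⟩
  · intro x hx
    obtain ⟨hxv, hx⟩ := Finset.mem_erase.mp (hl2 ▸ hx)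
    exact lt_of_le_of_ne (hmmin x (sub₁ hx) hxv) fun e => hJ.notMem₂ hx (e ▸ hmV₂)
  · intro x hx
    obtain ⟨hxm, hx⟩ := Finset.mem_erase.mp (hr2 ▸ hx)
    exact lt_of_le_of_ne (hm₂ x hx) hxm.symm
  · rw [hl2, hr2]
    exact hJ.disj.mono (Finset.erase_subset _ _) (Finset.erase_subset _ _)
  · rw [labels, hl2, hr2, ← Finset.union_insert, Finset.insert_erase hmV₂, hJ.verts,
      Finset.erase_union_distrib, Finset.erase_eq_of_notMem (hJ.notMem₂ hJ.mem₁)]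
  · rw [edges, hu, hl3, hr3, hJ.edges]
  · intro x hx
    rw [maxima_node, Finset.mem_union]
    rw [hJ.verts, Finset.mem_union] at hx
    rcases hx with hx | hx
    · rw [hl4 x hx]
      exact ⟨.inl, fun h => h.resolve_right fun h' => hJ.notMem₂ hx (hbsub x h')⟩
    · rw [hr4 x hx]
      refine ⟨.inr, fun h => h.resolve_left fun h' => hJ.notMem₁ hx ?_⟩
      exact Finset.mem_of_mem_erase (hl2 ▸ maxima_subset l h')

/-! ### Increasing binary trees and words -/

lemma mem_inorder (b : BinaryTree ℕ) (x : ℕ) : x ∈ b.inorder ↔ x ∈ b.labels := by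
  induction b with
  | nil => simp [inorder, labels]
  | node m l r hl hr => simp [inorder, labels, hl, hr]; tauto

lemma IsIncreasing.nodup_inorder {b : BinaryTree ℕ} (h : b.IsIncreasing) : b.inorder.Nodup := by
  induction b with
  | nil => exact List.nodup_nil
  | node m l r hl hr =>
    obtain ⟨h1, h2, h3, h4, h5⟩ := h
    rw [inorder, List.nodup_append]
    refine ⟨hl h4, List.nodup_cons.mpr ⟨fun hm => (h2 m ((mem_inorder r m).mp hm)).false, hr h5⟩, ?_⟩
    rintro x hx y hy rfl
    rw [mem_inorder] at hx
    rcases List.mem_cons.mp hy with rfl | hy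
    · exact (h1 _ hx).false
    · exact Finset.disjoint_left.mp h3 hx ((mem_inorder r x).mp hy)

lemma IsIncreasing.eq_of_inorder_eq {b b' : BinaryTree ℕ} (h : b.IsIncreasing)
    (h' : b'.IsIncreasing) (he : b.inorder = b'.inorder) : b = b' := by
  have hL : b.labels = b'.labels := by
    ext x
    rw [← mem_inorder, ← mem_inorder, he]
  induction b generalizing b' with
  | nil => exact ((labels_eq_empty_iff b').mp (hL ▸ rfl)).symm
  | node m l r hl hr =>
    cases b' with
    | nil => simp [labels] at hL
    | node m' l' r' =>
      obtain rfl := h.root_eq h' hL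
      obtain ⟨el, -, er⟩ := (List.append_cons_inj_of_notMem
        (fun hm => (h.1 m ((mem_inorder l m).mp hm)).false)
        (fun hm => (h.2.1 m ((mem_inorder r m).mp hm)).false)).mp he
      have ext_labels : ∀ {a a' : BinaryTree ℕ}, a.inorder = a'.inorder →
          a.labels = a'.labels := by
        intro a a' ha
        ext x
        rw [← mem_inorder, ← mem_inorder, ha]
      rw [hl h.2.2.2.1 h'.2.2.2.1 el (ext_labels el), hr h.2.2.2.2 h'.2.2.2.2 er (ext_labels er)]

lemma exists_inorder_eq {w : List ℕ} (hw : w.Nodup) :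
    ∃ b : BinaryTree ℕ, b.IsIncreasing ∧ b.inorder = w := by
  induction hc : w.length using Nat.strong_induction_on generalizing w with
  | _ c ih =>
  subst hc
  rcases w.toFinset.eq_empty_or_nonempty with he | he
  · exact ⟨nil, trivial, ((List.toFinset_eq_empty_iff w).mp he).symm⟩
  have hm := List.mem_toFinset.mp (Finset.min'_mem _ he)
  have hmin : ∀ x ∈ w, w.toFinset.min' he ≤ x := fun x hx =>
    Finset.min'_le _ _ (List.mem_toFinset.mpr hx)
  generalize w.toFinset.min' he = m at hm hmin
  obtain ⟨L, R, rfl⟩ := List.append_of_mem hm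
  obtain ⟨hL, hmR, hLR⟩ := List.nodup_append.mp hw
  obtain ⟨hmR, hR⟩ := List.nodup_cons.mp hmR
  obtain ⟨l, hl1, rfl⟩ := ih _ (by simp) hL rfl
  obtain ⟨r, hr1, rfl⟩ := ih _ (by simp; omega) hR rfl
  refine ⟨node m l r, ⟨fun x hx => ?_, fun x hx => ?_, ?_, hl1, hr1⟩, rfl⟩
  · rw [← mem_inorder] at hx
    exact lt_of_le_of_ne (hmin x (by simp [hx])) (hLR x hx m (by simp)).symm
  · rw [← mem_inorder] at hx
    exact lt_of_le_of_ne (hmin x (by simp [hx])) fun e => hmR (e ▸ hx)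
  · rw [Finset.disjoint_left]
    intro x hx hx'
    rw [← mem_inorder] at hx hx'
    exact hLR x hx x (by simp [hx']) rfl

/-- The number of maxima exceeds the number of descents of the reading word by one. -/
lemma IsIncreasing.card_maxima {b : BinaryTree ℕ} (h : b.IsIncreasing) :
    b.maxima.card = if b = nil then 0 else descCount b.inorder + 1 := by
  induction b with
  | nil => simp [maxima]
  | node m l r hl hr =>
    obtain ⟨h1, h2, h3, h4, h5⟩ := h
    have hd : Disjoint l.maxima (branchMaxima m r) := by
      refine Finset.disjoint_of_subset_left (maxima_subset l)
        (Finset.disjoint_of_subset_right (branchMaxima_subset m r) ?_)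
      rw [Finset.disjoint_insert_right]
      exact ⟨fun hm => (h1 m hm).false, h3⟩
    have hnil : ∀ a : BinaryTree ℕ, a.inorder = [] ↔ a = nil := by
      intro a
      cases a <;> simp [inorder]
    have hbr : (branchMaxima m r).card = descCount r.inorder + 1 := by
      by_cases hrn : r = nil
      · subst hrn
        simp [branchMaxima_nil, inorder, descCount]
      · rw [branchMaxima_of_ne_nil m hrn, hr h5, if_neg hrn]
    rw [if_neg (by simp : node m l r ≠ nil), maxima_node, Finset.card_union_of_disjoint hd, hl h4, hbr,
      inorder, descCount_append_cons _ _ (fun x hx => h1 x ((mem_inorder l x).mp hx))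
        (fun x hx => h2 x ((mem_inorder r x).mp hx))]
    simp only [hnil]
    split_ifs with hln
    · subst hln
      simp [inorder, descCount]
    · omega

end BinaryTree

lemma descCount_map_succ (l : List ℕ) : descCount (l.map (· + 1)) = descCount l := by
  induction l with
  | nil => rfl
  | cons a l ih =>
    cases l with
    | nil => rfl
    | cons b l =>
      simp only [List.map_cons, descCount] at ih ⊢
      rw [ih]
      simp

/-- Permutations, as words in the letters `2, …, n + 1`. -/
lemma bijOn_permList (n k : ℕ) :
    Set.BijOn (fun π : Equiv.Perm (Fin n) => (permList π).map (· + 1))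
      {π | descCount (permList π) = k}
      {w | w.Nodup ∧ w.toFinset = Finset.Icc 2 (n + 1) ∧ descCount w = k} := by
  refine ⟨fun π hπ => ⟨?_, ?_, ?_⟩, fun π _ σ _ h => ?_, fun w hw => ?_⟩
  · simp only [permList, List.map_map]
    refine (List.nodup_finRange n).map fun i j hij => ?_
    simpa [Fin.val_inj] using hij
  · ext x
    simp only [permList, List.map_map, List.mem_toFinset, List.mem_map, List.mem_finRange,
      true_and, Function.comp, Finset.mem_Icc]
    constructor
    · rintro ⟨i, rfl⟩
      have := (π i).isLt
      omega
    · rintro ⟨h1, h2⟩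
      refine ⟨π.symm ⟨x - 2, by omega⟩, ?_⟩
      simp only [Equiv.apply_symm_apply]
      omega
  · rw [descCount_map_succ]
    exact hπ
  · have h' := List.map_injective_iff.mpr (add_left_injective 1) h
    simp only [permList, List.map_inj_left, List.mem_finRange, true_imp_iff] at h'
    ext i
    exact Nat.add_right_cancel (h' i)
  · obtain ⟨hnd, hfin, hdes⟩ := hw
    have hlen : w.length = n := by
      rw [← List.toFinset_card_of_nodup hnd, hfin]
      simp
    have hb : ∀ i (hi : i < w.length), 2 ≤ w[i] ∧ w[i] ≤ n + 1 := fun i hi =>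
      Finset.mem_Icc.mp (hfin ▸ List.mem_toFinset.mpr (List.getElem_mem hi))
    let f : Fin n → Fin n := fun i =>
      ⟨w[i.val]'(by omega) - 2, by have := hb i.val (by omega); omega⟩
    have hf : Function.Injective f := by
      intro i j hij
      have h1 := hb i.val (by omega)
      have h2 := hb j.val (by omega)
      have h3 : w[i.val]'(by omega) - 2 = w[j.val]'(by omega) - 2 := congrArg Fin.val hij
      exact Fin.ext ((hnd.getElem_inj_iff).mp (by omega))
    have hw : (permList (Equiv.ofBijective f (Finite.injective_iff_bijective.mp hf))).map (· + 1)
        = w := by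
      refine List.ext_getElem (by simp [permList, hlen]) fun i h1 h2 => ?_
      have := hb i h2
      simp [permList, f]
      omega
    refine ⟨_, ?_, hw⟩
    rw [Set.mem_ofPred_eq, ← descCount_map_succ, hw]
    exact hdes

lemma bijOn_inorder (n k : ℕ) (hn : 1 ≤ n) :
    Set.BijOn BinaryTree.inorder
      {b | b.IsIncreasing ∧ b.labels = Finset.Icc 2 (n + 1) ∧ b.maxima.card = k + 1}
      {w | w.Nodup ∧ w.toFinset = Finset.Icc 2 (n + 1) ∧ descCount w = k} := by
  have toFinset_inorder : ∀ b : BinaryTree ℕ, b.inorder.toFinset = b.labels := fun b => by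
    ext x
    rw [List.mem_toFinset, b.mem_inorder]
  have ne_nil : ∀ b : BinaryTree ℕ, b.labels = Finset.Icc 2 (n + 1) → b ≠ .nil := by
    rintro b hb rfl
    exact absurd hb.symm (Finset.nonempty_iff_ne_empty.mp ⟨2, by simp; omega⟩)
  refine ⟨?_, fun b hb b' hb' h => hb.1.eq_of_inorder_eq hb'.1 h, ?_⟩
  · rintro b ⟨h1, h2, h3⟩
    rw [h1.card_maxima, if_neg (ne_nil b h2)] at h3
    exact ⟨h1.nodup_inorder, (toFinset_inorder b).trans h2, by omega⟩
  · rintro w ⟨h1, h2, h3⟩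
    obtain ⟨b, hb, rfl⟩ := BinaryTree.exists_inorder_eq h1
    rw [toFinset_inorder] at h2
    refine ⟨b, ⟨hb, h2, ?_⟩, rfl⟩
    rw [hb.card_maxima, if_neg (ne_nil b h2), h3]

/-- The weight zero maxmin tree encoded by a binary tree with labels `2, …, n + 1`. -/
noncomputable def BinaryTree.maxminTree (n : ℕ) (b : BinaryTree ℕ) :
    Finset (Sym2 ℕ) × (ℕ → ℕ) :=
  (b.edges 1, fun x => if x ∈ b.maxima then 2 else if x ∈ Finset.Icc 1 (n + 1) then 1 else 0)

lemma bijOn_maxminTree (n k : ℕ) (hn : 1 ≤ n) :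
    Set.BijOn (BinaryTree.maxminTree n)
      {b | b.IsIncreasing ∧ b.labels = Finset.Icc 2 (n + 1) ∧ b.maxima.card = k + 1}
      {T : Finset (Sym2 ℕ) × (ℕ → ℕ) |
        IsTreeOn (Finset.Icc 1 (n + 1)) T.1 ∧
        IsTieredOn (Finset.Icc 1 (n + 1)) T.1 2 T.2 ∧
        (∀ j ∈ Finset.Icc 1 2, ∃ v ∈ Finset.Icc 1 (n + 1), T.2 v = j) ∧
        (∀ x, x ∉ Finset.Icc 1 (n + 1) → T.2 x = 0) ∧
        treeWeight (Finset.Icc 1 (n + 1)) T.1 T.2 = 0 ∧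
        ((Finset.Icc 1 (n + 1)).filter fun v => T.2 v = 2).card = k + 1} := by
  have hV : insert 1 (Finset.Icc 2 (n + 1)) = Finset.Icc 1 (n + 1) := by
    ext x
    simp only [Finset.mem_insert, Finset.mem_Icc]
    omega
  have hV' : (Finset.Icc 1 (n + 1)).erase 1 = Finset.Icc 2 (n + 1) := by
    ext x
    simp only [Finset.mem_erase, Finset.mem_Icc]
    omega
  have lt_labels : ∀ b : BinaryTree ℕ, b.labels = Finset.Icc 2 (n + 1) → ∀ x ∈ b.labels, 1 < x :=
    fun b hb x hx => (Finset.mem_Icc.mp (hb ▸ hx)).1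
  have maxima_lt : ∀ b : BinaryTree ℕ, b.labels = Finset.Icc 2 (n + 1) → ∀ x ∈ b.maxima,
      2 ≤ x ∧ x ≤ n + 1 := fun b hb x hx => Finset.mem_Icc.mp (hb ▸ b.maxima_subset hx)
  have tier_eq_two : ∀ (b : BinaryTree ℕ) x, (b.maxminTree n).2 x = 2 ↔ x ∈ b.maxima := by
    intro b x
    simp only [BinaryTree.maxminTree]
    split_ifs <;> simp_all
  refine ⟨?_, ?_, ?_⟩
  · rintro b ⟨h1, h2, h3⟩
    have hlt := lt_labels b h2
    have htree := h1.isTreeOn hlt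
    have htier := h1.isTieredOn_and_treeWeight_eq_zero hlt (t := (b.maxminTree n).2) (by
      intro x hx
      rw [h2, hV] at hx
      simp only [BinaryTree.maxminTree, hx, if_true])
    rw [h2, hV] at htree htier
    have hmax : (Finset.Icc 1 (n + 1)).filter (fun v => (b.maxminTree n).2 v = 2) = b.maxima := by
      ext x
      rw [Finset.mem_filter, tier_eq_two, Finset.mem_Icc]
      refine ⟨fun h => h.2, fun h => ⟨?_, h⟩⟩
      have := maxima_lt b h2 x h
      omega
    refine ⟨htree, htier.1, ?_, ?_, htier.2, by rw [hmax, h3]⟩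
    · intro j hj
      obtain rfl | rfl : j = 1 ∨ j = 2 := by
        rw [Finset.mem_Icc] at hj
        omega
      · refine ⟨1, by simp, ?_⟩
        have : 1 ∉ b.maxima := fun h => by have := maxima_lt b h2 1 h; omega
        simp [BinaryTree.maxminTree, this]
      · obtain ⟨x, hx⟩ := Finset.card_pos.mp (by omega : 0 < b.maxima.card)
        have := maxima_lt b h2 x hx
        exact ⟨x, Finset.mem_Icc.mpr ⟨by omega, this.2⟩, (tier_eq_two b x).mpr hx⟩
    · intro x hx
      have : x ∉ b.maxima := fun h => by
        have := maxima_lt b h2 x h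
        rw [Finset.mem_Icc] at hx
        omega
      simp only [BinaryTree.maxminTree, this, hx, if_false]
  · rintro b ⟨h1, h2, -⟩ b' ⟨h1', h2', -⟩ h
    exact h1.eq_of_edges_eq h1' (h2.trans h2'.symm) (lt_labels b h2) (congrArg Prod.fst h)
  · rintro ⟨E, t⟩ ⟨hT, ht, -, h0, hw, hc⟩
    have h1mem : 1 ∈ Finset.Icc 1 (n + 1) := by simp
    have h1min : ∀ x ∈ Finset.Icc 1 (n + 1), 1 ≤ x := fun x hx => (Finset.mem_Icc.mp hx).1
    have ht1 : t 1 = 1 := by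
      obtain ⟨x, hx, hx1, hadj⟩ := hT.exists_neighbor (w := 2) h1mem
        (Finset.mem_Icc.mpr ⟨by omega, by omega⟩) (by omega)
      have h1 := ht.2 1 x hadj (by have := h1min x hx; omega)
      have h2 := Finset.mem_Icc.mp (ht.1 x hx)
      have h3 := Finset.mem_Icc.mp (ht.1 1 h1mem)
      simp only at h1 h2 h3
      omega
    obtain ⟨b, hb1, hb2, hb3, hb4⟩ :=
      BinaryTree.exists_isIncreasing_of_treeWeight_eq_zero hT ht hw h1mem h1min ht1
    rw [hV'] at hb2
    refine ⟨b, ⟨hb1, hb2, ?_⟩, Prod.ext hb3 (funext fun x => ?_)⟩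
    · rw [← hc]
      congr 1
      ext x
      rw [Finset.mem_filter]
      constructor
      · intro hx
        have := maxima_lt b hb2 x hx
        have hxV : x ∈ Finset.Icc 1 (n + 1) := Finset.mem_Icc.mpr ⟨by omega, this.2⟩
        exact ⟨hxV, (hb4 x hxV).mpr hx⟩
      · exact fun hx => (hb4 x hx.1).mp hx.2
    · simp only [BinaryTree.maxminTree]
      by_cases hxV : x ∈ Finset.Icc 1 (n + 1)
      · have h1 := hb4 x hxV
        have h2 := Finset.mem_Icc.mp (ht.1 x hxV)
        simp only at h1 h2
        by_cases hx : x ∈ b.maxima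
        · rw [if_pos hx, h1.mpr hx]
        · have : t x ≠ 2 := fun h => hx (h1.mp h)
          rw [if_neg hx, if_pos hxV]
          omega
      · have hx : x ∉ b.maxima := fun h => by
          have := maxima_lt b hb2 x h
          rw [Finset.mem_Icc] at hxV
          omega
        rw [if_neg hx, if_neg hxV]
        exact (h0 x hxV).symm

/-- For `n ≥ 1` and `0 ≤ k ≤ n−1`, the number of weight `0` maxmin
trees on `n+1` vertices (tiered trees on `{1,…,n+1}` with two tiers, surjectively
tiered) having exactly `k+1` maxima (vertices on tier `2`) equals the Eulerian number
`A(k,n)`, the number of permutations in `S_n` with exactly `k` descents. -/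
theorem weight_zero_maxmin_trees_eq_eulerian (n k : ℕ) (hn : 1 ≤ n) (hk : k ≤ n - 1) :
    Nat.card {T : Finset (Sym2 ℕ) × (ℕ → ℕ) |
        IsTreeOn (Finset.Icc 1 (n + 1)) T.1 ∧
        IsTieredOn (Finset.Icc 1 (n + 1)) T.1 2 T.2 ∧
        (∀ j ∈ Finset.Icc 1 2, ∃ v ∈ Finset.Icc 1 (n + 1), T.2 v = j) ∧
        (∀ x, x ∉ Finset.Icc 1 (n + 1) → T.2 x = 0) ∧
        treeWeight (Finset.Icc 1 (n + 1)) T.1 T.2 = 0 ∧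
        ((Finset.Icc 1 (n + 1)).filter fun v => T.2 v = 2).card = k + 1}
      = Nat.card {π : Equiv.Perm (Fin n) | descCount (permList π) = k} := by
  exact (Nat.card_congr (bijOn_maxminTree n k hn).equiv).symm.trans
    ((Nat.card_congr (bijOn_inorder n k hn).equiv).trans
      (Nat.card_congr (bijOn_permList n k).equiv).symm)
end

section
/- For each n ≥ 2 there is exactly one maxmin tree on n vertices with exactly 1 maximum and exactly one maxmin tree on n vertices with exactly n−1 maxima, and both of these trees have weight 0. -/
open scoped Classical

/-- The set of maxmin trees on `{1,…,n}`: tiered trees with two tiers whose tiering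
function is surjective onto `{1, 2}`, encoded as pairs `(E, t)` of an edge set and a
tiering function, normalised to vanish off `{1,…,n}`. -/
def MaxminTrees (n : ℕ) : Set (Finset (Sym2 ℕ) × (ℕ → ℕ)) :=
  {T | IsTreeOn (Finset.Icc 1 n) T.1 ∧ IsTieredOn (Finset.Icc 1 n) T.1 2 T.2 ∧
    (∀ j ∈ Finset.Icc 1 2, ∃ v ∈ Finset.Icc 1 n, T.2 v = j) ∧
    ∀ x, x ∉ Finset.Icc 1 n → T.2 x = 0}

/-- The number of maxima (vertices on the top tier `2`) of a maxmin tree. -/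
def maximaCount (n : ℕ) (T : Finset (Sym2 ℕ) × (ℕ → ℕ)) : ℕ :=
  ((Finset.Icc 1 n).filter fun v => T.2 v = 2).card

/-- The edges of the star on the vertex set `V` with center `c`. -/
noncomputable def starEdges (V : Finset ℕ) (c : ℕ) : Finset (Sym2 ℕ) :=
  (V.erase c).image fun v => s(c, v)

/-- The tiering function on `{1,…,n}` equal to `i` at `c` and to `j` elsewhere. -/
def starTier (n c i j : ℕ) (x : ℕ) : ℕ :=
  if x = c then i else if 1 ≤ x ∧ x ≤ n then j else 0

theorem mem_starEdges {V : Finset ℕ} {c a b : ℕ} :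
    s(a, b) ∈ starEdges V c ↔ a ≠ b ∧ (a = c ∧ b ∈ V ∨ b = c ∧ a ∈ V) := by
  simp only [starEdges, Finset.mem_image, Finset.mem_erase, Sym2.eq_iff]
  constructor
  · rintro ⟨v, ⟨hv, hV⟩, ⟨rfl, rfl⟩ | ⟨rfl, rfl⟩⟩
    · exact ⟨hv.symm, .inl ⟨rfl, hV⟩⟩
    · exact ⟨hv, .inr ⟨rfl, hV⟩⟩
  · rintro ⟨hab, ⟨rfl, hb⟩ | ⟨rfl, ha⟩⟩
    · exact ⟨b, ⟨hab.symm, hb⟩, .inl ⟨rfl, rfl⟩⟩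
    · exact ⟨a, ⟨hab, ha⟩, .inr ⟨rfl, rfl⟩⟩

theorem card_starEdges {V : Finset ℕ} {c : ℕ} (hc : c ∈ V) :
    (starEdges V c).card + 1 = V.card := by
  rw [starEdges, Finset.card_image_of_injective, Finset.card_erase_add_one hc]
  intro a b h
  exact Sym2.congr_right.mp h

theorem isTreeOn_starEdges {V : Finset ℕ} {c : ℕ} (hc : c ∈ V) :
    IsTreeOn V (starEdges V c) := by
  refine ⟨?_, ?_, ?_, card_starEdges hc⟩
  · intro e he x hx
    simp only [starEdges, Finset.mem_image, Finset.mem_erase] at he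
    obtain ⟨v, ⟨-, hv⟩, rfl⟩ := he
    rcases Sym2.mem_iff.mp hx with rfl | rfl <;> assumption
  · intro e he
    simp only [starEdges, Finset.mem_image, Finset.mem_erase] at he
    obtain ⟨v, ⟨hvc, -⟩, rfl⟩ := he
    simpa using hvc.symm
  · intro a ha b hb
    have h₁ : EReach (starEdges V c) a c := by
      by_cases h : a = c
      · rw [h]; exact .refl
      · exact .single (mem_starEdges.mpr ⟨h, .inr ⟨rfl, ha⟩⟩)
    have h₂ : EReach (starEdges V c) c b := by
      by_cases h : b = c
      · rw [h]; exact .refl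
      · exact .single (mem_starEdges.mpr ⟨Ne.symm h, .inl ⟨rfl, hb⟩⟩)
    exact h₁.trans h₂

/-- If all vertices other than `c` lie on the same tier, the tree is a star centered at `c`. -/
theorem IsTreeOn.eq_starEdges {V : Finset ℕ} {E : Finset (Sym2 ℕ)} {t : ℕ → ℕ} {m c k : ℕ}
    (hE : IsTreeOn V E) (ht : IsTieredOn V E m t) (hc : c ∈ V)
    (hk : ∀ x ∈ V, x ≠ c → t x = k) : E = starEdges V c := by
  obtain ⟨hV, hdiag, -, hcard⟩ := hE
  refine Finset.eq_of_subset_of_card_le ?_ ?_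
  · intro e he
    induction e with
    | _ a b =>
      have ha : a ∈ V := hV _ he a (Sym2.mem_mk_left a b)
      have hb : b ∈ V := hV _ he b (Sym2.mem_mk_right a b)
      have hab : a ≠ b := by simpa using hdiag _ he
      refine mem_starEdges.mpr ⟨hab, ?_⟩
      by_contra hcon
      have hac : a ≠ c := fun h => hcon (.inl ⟨h, hb⟩)
      have hbc : b ≠ c := fun h => hcon (.inr ⟨h, ha⟩)
      have hka := hk a ha hac
      have hkb := hk b hb hbc
      rcases lt_or_gt_of_ne hab with h | h
      · have := ht.2 a b he h
        omega
      · have := ht.2 b a (Sym2.eq_swap ▸ he) h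
        omega
  · have := card_starEdges hc
    omega

theorem starTier_mem_maxminTrees_top {n : ℕ} (hn : 2 ≤ n) :
    (starEdges (Finset.Icc 1 n) n, starTier n n 2 1) ∈ MaxminTrees n := by
  refine ⟨isTreeOn_starEdges (by simp; omega), ⟨?_, ?_⟩, ?_, ?_⟩
  · intro v hv
    simp only [Finset.mem_Icc, starTier] at hv ⊢
    grind
  · intro a b hab hlt
    simp only [mem_starEdges, Finset.mem_Icc, starTier] at hab ⊢
    grind
  · intro j hj
    simp only [Finset.mem_Icc, starTier] at hj ⊢
    obtain rfl | rfl : j = 1 ∨ j = 2 := by omega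
    · exact ⟨1, by grind⟩
    · exact ⟨n, by grind⟩
  · intro x hx
    simp only [Finset.mem_Icc, starTier] at hx ⊢
    grind

theorem starTier_mem_maxminTrees_bot {n : ℕ} (hn : 2 ≤ n) :
    (starEdges (Finset.Icc 1 n) 1, starTier n 1 1 2) ∈ MaxminTrees n := by
  refine ⟨isTreeOn_starEdges (by simp; omega), ⟨?_, ?_⟩, ?_, ?_⟩
  · intro v hv
    simp only [Finset.mem_Icc, starTier] at hv ⊢
    grind
  · intro a b hab hlt
    simp only [mem_starEdges, Finset.mem_Icc, starTier] at hab ⊢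
    grind
  · intro j hj
    simp only [Finset.mem_Icc, starTier] at hj ⊢
    obtain rfl | rfl : j = 1 ∨ j = 2 := by omega
    · exact ⟨1, by grind⟩
    · exact ⟨n, by grind⟩
  · intro x hx
    simp only [Finset.mem_Icc, starTier] at hx ⊢
    grind

theorem maximaCount_starTier_top {n : ℕ} (hn : 2 ≤ n) (E : Finset (Sym2 ℕ)) :
    maximaCount n (E, starTier n n 2 1) = 1 := by
  rw [maximaCount, Finset.card_eq_one]
  refine ⟨n, ?_⟩
  ext x
  grind [starTier]

theorem maximaCount_starTier_bot {n : ℕ} (hn : 2 ≤ n) (E : Finset (Sym2 ℕ)) :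
    maximaCount n (E, starTier n 1 1 2) = n - 1 := by
  have h : (Finset.Icc 1 n).filter (fun v => starTier n 1 1 2 v = 2) = Finset.Icc 2 n := by
    ext x
    grind [starTier]
  simp only [maximaCount, h, Nat.card_Icc]
  omega

theorem eq_star_of_maximaCount_eq_one {n : ℕ} (hn : 2 ≤ n) {T : Finset (Sym2 ℕ) × (ℕ → ℕ)}
    (hT : T ∈ MaxminTrees n) (h : maximaCount n T = 1) :
    T = (starEdges (Finset.Icc 1 n) n, starTier n n 2 1) := by
  obtain ⟨E, t⟩ := T
  obtain ⟨htree, htier, -, hzero⟩ := hT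
  obtain ⟨c, hc⟩ := Finset.card_eq_one.mp h
  have hmem : ∀ x, (x ∈ Finset.Icc 1 n ∧ t x = 2) ↔ x = c := fun x => by
    simpa using Finset.ext_iff.mp hc x
  obtain ⟨hcV, hct⟩ := (hmem c).mpr rfl
  have hone : ∀ x ∈ Finset.Icc 1 n, x ≠ c → t x = 1 := fun x hx hxc => by
    have h₁ := Finset.mem_Icc.mp (htier.1 x hx)
    have h₂ : t x ≠ 2 := fun h => hxc ((hmem x).mp ⟨hx, h⟩)
    dsimp only at h₁
    omega
  have hE : E = starEdges (Finset.Icc 1 n) c := htree.eq_starEdges htier hcV hone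
  obtain rfl : n = c := by
    by_contra hne
    have hn' : n ∈ Finset.Icc 1 n := by simp; omega
    have hlt := htier.2 c n
      (by simp only [hE]; exact mem_starEdges.mpr ⟨Ne.symm hne, .inl ⟨rfl, hn'⟩⟩)
      (lt_of_le_of_ne (Finset.mem_Icc.mp hcV).2 (Ne.symm hne))
    have := hone n hn' hne
    dsimp only at hlt
    omega
  refine Prod.ext hE (funext fun x => ?_)
  have hz := hzero x
  have ho := hone x
  simp only [Finset.mem_Icc, starTier] at hz ho ⊢
  grind

theorem eq_star_of_maximaCount_eq_pred {n : ℕ} (hn : 2 ≤ n) {T : Finset (Sym2 ℕ) × (ℕ → ℕ)}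
    (hT : T ∈ MaxminTrees n) (h : maximaCount n T = n - 1) :
    T = (starEdges (Finset.Icc 1 n) 1, starTier n 1 1 2) := by
  obtain ⟨E, t⟩ := T
  obtain ⟨htree, htier, -, hzero⟩ := hT
  have hcard : ((Finset.Icc 1 n).filter fun v => ¬ t v = 2).card = 1 := by
    have := Finset.card_filter_add_card_filter_not (s := Finset.Icc 1 n) (fun v => t v = 2)
    simp only [maximaCount] at h
    rw [h, Nat.card_Icc] at this
    omega
  obtain ⟨c, hc⟩ := Finset.card_eq_one.mp hcard
  have hmem : ∀ x, (x ∈ Finset.Icc 1 n ∧ ¬ t x = 2) ↔ x = c := fun x => by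
    simpa using Finset.ext_iff.mp hc x
  obtain ⟨hcV, hct⟩ := (hmem c).mpr rfl
  have hct' : t c = 1 := by
    have h₁ := Finset.mem_Icc.mp (htier.1 c hcV)
    dsimp only at h₁
    omega
  have htwo : ∀ x ∈ Finset.Icc 1 n, x ≠ c → t x = 2 := fun x hx hxc => by
    by_contra h
    exact hxc ((hmem x).mp ⟨hx, h⟩)
  have hE : E = starEdges (Finset.Icc 1 n) c := htree.eq_starEdges htier hcV htwo
  obtain rfl : 1 = c := by
    by_contra hne
    have h1 : 1 ∈ Finset.Icc 1 n := by simp; omega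
    have hlt := htier.2 1 c
      (by simp only [hE]; exact mem_starEdges.mpr ⟨hne, .inr ⟨rfl, h1⟩⟩)
      (lt_of_le_of_ne (Finset.mem_Icc.mp hcV).1 hne)
    have := htwo 1 h1 hne
    dsimp only at hlt
    omega
  refine Prod.ext hE (funext fun x => ?_)
  have hz := hzero x
  have ho := htwo x
  simp only [Finset.mem_Icc, starTier] at hz ho ⊢
  grind

theorem treeWeightAux_of_card_lt_two (t : ℕ → ℕ) (fuel : ℕ) {V : Finset ℕ}
    (E : Finset (Sym2 ℕ)) (hV : V.card < 2) : treeWeightAux t fuel V E = 0 := by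
  cases fuel with
  | zero => rfl
  | succ fuel => rw [treeWeightAux, dif_neg (by omega)]

theorem treeWeightAux_eq_zero_of_max_center {t : ℕ → ℕ} {c k : ℕ} (fuel : ℕ) {V : Finset ℕ}
    {E : Finset (Sym2 ℕ)} (hmax : ∀ x ∈ V, x ≤ c) (ht : ∀ x ∈ V, x ≠ c → t x = k)
    (hE : ∀ e ∈ E, c ∈ e) : treeWeightAux t fuel V E = 0 := by
  induction fuel generalizing V E with
  | zero => rfl
  | succ fuel ih =>
    rw [treeWeightAux]
    split_ifs with hcard
    · have hne : V.Nonempty := Finset.card_pos.mp (by omega)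
      have hvV : V.min' hne ∈ V := V.min'_mem hne
      have hvc : V.min' hne ≠ c := fun h => by
        have : V.card ≤ 1 := Finset.card_le_one.mpr fun a ha b hb => by
          have h₁ := V.min'_le a ha
          have h₂ := V.min'_le b hb
          have h₃ := hmax a ha
          have h₄ := hmax b hb
          omega
        omega
      refine Finset.sum_eq_zero fun u hu => ?_
      have huc : u = c := by
        rcases Sym2.mem_iff.mp (hE _ (Finset.mem_filter.mp hu).2) with h | h
        · exact absurd h.symm hvc
        · exact h.symm
      refine Nat.add_eq_zero_iff.mpr ⟨?_, ?_⟩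
      · rw [Finset.card_eq_zero, Finset.filter_eq_empty_iff]
        rintro x hx ⟨hlt, hxu⟩
        have hxV := Finset.mem_of_mem_erase (Finset.mem_filter.mp hx).1
        rw [ht _ hvV hvc, ht x hxV (by omega)] at hlt
        exact lt_irrefl _ hlt
      · refine ih ?_ ?_ ?_
        · exact fun x hx => hmax x (Finset.mem_of_mem_erase (Finset.mem_filter.mp hx).1)
        · exact fun x hx => ht x (Finset.mem_of_mem_erase (Finset.mem_filter.mp hx).1)
        · exact fun e he => hE e (Finset.mem_filter.mp (Finset.mem_filter.mp he).1).1
    · rfl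

theorem eReach_empty {a b : ℕ} : EReach ∅ a b ↔ a = b := by
  constructor
  · intro h
    induction h with
    | refl => rfl
    | tail _ h _ => simp at h
  · rintro rfl
    exact .refl

theorem treeWeightAux_eq_zero_of_min_center {t : ℕ → ℕ} {c : ℕ} (fuel : ℕ) {V : Finset ℕ}
    {E : Finset (Sym2 ℕ)} (hc : c ∈ V) (hmin : ∀ x ∈ V, c ≤ x)
    (hE : ∀ e ∈ E, c ∈ e) : treeWeightAux t fuel V E = 0 := by
  cases fuel with
  | zero => rfl
  | succ fuel =>
    rw [treeWeightAux]
    split_ifs with hcard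
    · have hne : V.Nonempty := ⟨c, hc⟩
      have hv : V.min' hne = c := le_antisymm (V.min'_le c hc) (hmin _ (V.min'_mem hne))
      have hempty : E.filter (fun e => V.min' hne ∉ e) = ∅ := by
        rw [Finset.filter_eq_empty_iff, hv]
        exact fun e he h => h (hE e he)
      refine Finset.sum_eq_zero fun u _ => ?_
      have hC : ∀ x ∈ (V.erase (V.min' hne)).filter
          (fun x => EReach (E.filter fun e => V.min' hne ∉ e) u x), x = u := fun x hx => by
        have h := (Finset.mem_filter.mp hx).2
        rw [hempty, eReach_empty] at h
        exact h.symm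
      refine Nat.add_eq_zero_iff.mpr ⟨?_, ?_⟩
      · rw [Finset.card_eq_zero, Finset.filter_eq_empty_iff]
        rintro x hx ⟨-, hxu⟩
        exact hxu.ne (hC x hx)
      · refine treeWeightAux_of_card_lt_two _ _ _ (Nat.lt_succ_of_le ?_)
        exact Finset.card_le_one.mpr fun a ha b hb => (hC a ha).trans (hC b hb).symm
    · rfl

theorem center_mem_of_mem_starEdges {V : Finset ℕ} {c : ℕ} {e : Sym2 ℕ}
    (he : e ∈ starEdges V c) : c ∈ e := by
  obtain ⟨v, -, rfl⟩ := Finset.mem_image.mp he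
  exact Sym2.mem_mk_left c v

/-- For `n ≥ 2` there is exactly one maxmin tree on `n` vertices
with exactly `1` maximum and exactly one with exactly `n−1` maxima, and both of these
trees have weight `0`. -/
theorem unique_extreme_maxmin_trees_weight_zero (n : ℕ) (hn : 2 ≤ n) :
    (∃! T : Finset (Sym2 ℕ) × (ℕ → ℕ), T ∈ MaxminTrees n ∧ maximaCount n T = 1) ∧
    (∃! T : Finset (Sym2 ℕ) × (ℕ → ℕ), T ∈ MaxminTrees n ∧ maximaCount n T = n - 1) ∧
    ∀ T ∈ MaxminTrees n, (maximaCount n T = 1 ∨ maximaCount n T = n - 1) →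
      treeWeight (Finset.Icc 1 n) T.1 T.2 = 0 := by
  refine ⟨⟨_, ⟨starTier_mem_maxminTrees_top hn, maximaCount_starTier_top hn _⟩,
      fun T hT => eq_star_of_maximaCount_eq_one hn hT.1 hT.2⟩,
    ⟨_, ⟨starTier_mem_maxminTrees_bot hn, maximaCount_starTier_bot hn _⟩,
      fun T hT => eq_star_of_maximaCount_eq_pred hn hT.1 hT.2⟩, ?_⟩
  rintro T hT (h | h)
  · rw [eq_star_of_maximaCount_eq_one hn hT h]
    refine treeWeightAux_eq_zero_of_max_center (c := n) (k := 1) _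
      (fun x hx => (Finset.mem_Icc.mp hx).2) (fun x hx hxn => ?_)
      fun e he => center_mem_of_mem_starEdges he
    simp only [starTier, if_neg hxn, if_pos (Finset.mem_Icc.mp hx)]
  · rw [eq_star_of_maximaCount_eq_pred hn hT h]
    exact treeWeightAux_eq_zero_of_min_center (c := 1) _ (Finset.mem_Icc.mpr ⟨le_rfl, by omega⟩)
      (fun x hx => (Finset.mem_Icc.mp hx).1) fun e he => center_mem_of_mem_starEdges he
end
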